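/- arXiv:1805.03815 — 5 statements merged into one kernel-verified Lean document; each statement's English description precedes it below -/
import Mathlib

section
/- For any altitude H > 0, half-beamwidth Θ ∈ (0, π/2), and horizontal position x ≥ D/2, the sum of received powers does not exceed its value at x = D/2, i.e., Q₁(x, H, Θ) + Q₂(x, H, Θ) ≤ Q₁(D/2, H, Θ) + Q₂(D/2, H, Θ). (Hence the UAV never benefits from hovering horizontally outside the segment between the two ERs.) -/
open Real MeasureTheory

/-- Received power at an ER located at `xhat` from a UAV at horizontal position `x`,
altitude `H`, with half-power beamwidth `Θ`. -/
noncomputable def Q (β₀ G₀ P xhat x H Θ : ℝ) : ℝ :=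
  if |x - xhat| / H ≤ Real.tan Θ then β₀ * G₀ * P / (Θ ^ 2 * ((x - xhat) ^ 2 + H ^ 2)) else 0

/-- The received power is a nonincreasing function of the horizontal distance to the ER. -/
theorem Q_le_Q_of_abs_le {β₀ G₀ P H Θ a b x y : ℝ} (hc : 0 ≤ β₀ * G₀ * P) (hH : 0 < H)
    (hΘ : Θ ≠ 0) (h : |y - b| ≤ |x - a|) :
    Q β₀ G₀ P a x H Θ ≤ Q β₀ G₀ P b y H Θ := by
  unfold Q
  by_cases hx : |x - a| / H ≤ Real.tan Θ
  · have hy : |y - b| / H ≤ Real.tan Θ := le_trans (by gcongr) hx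
    rw [if_pos hx, if_pos hy]
    have hsq : (y - b) ^ 2 ≤ (x - a) ^ 2 := sq_le_sq.mpr h
    gcongr
  · rw [if_neg hx]
    split_ifs <;> positivity

/-- For `x ≥ D/2` the sum of received powers does not exceed its value at `x = D/2`:
the UAV never benefits from hovering horizontally outside the segment between the two ERs. -/
theorem stmt_3 (β₀ G₀ P D : ℝ) (hβ : 0 < β₀) (hG : 0 < G₀) (hP : 0 < P) (hD : 0 < D)
    (x H Θ : ℝ) (hH : 0 < H) (hΘ : Θ ∈ Set.Ioo 0 (π / 2)) (hx : D / 2 ≤ x) :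
    Q β₀ G₀ P (-(D / 2)) x H Θ + Q β₀ G₀ P (D / 2) x H Θ ≤
      Q β₀ G₀ P (-(D / 2)) (D / 2) H Θ + Q β₀ G₀ P (D / 2) (D / 2) H Θ := by
  have hc : 0 ≤ β₀ * G₀ * P := by positivity
  have hΘ' : Θ ≠ 0 := hΘ.1.ne'
  apply add_le_add <;> apply Q_le_Q_of_abs_le hc hH hΘ'
  · exact abs_le_abs_of_nonneg (by linarith) (by linarith)
  · exact abs_le_abs_of_nonneg (by linarith) (by linarith)
end

section
/- Let 0 < H_min and 0 < Θ_min < π/2. For every x ∈ ℝ, H ≥ H_min, and Θ ∈ [Θ_min, π/2), the received power at ER 2 satisfies Q₂(x, H, Θ) ≤ β₀·G₀·P/(Θ_min²·H_min²), and this bound is attained at x = D/2, H = H_min, Θ = Θ_min, i.e., Q₂(D/2, H_min, Θ_min) = β₀·G₀·P/(Θ_min²·H_min²). (This is the optimal solution and value, equations (11)–(12), of the single-ER case of the hovering optimization problem.) -/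
open Real MeasureTheory

/-- Single-ER case of the hovering optimization: the received power at ER 2 is upper-bounded
by `β₀·G₀·P/(Θmin²·Hmin²)`, and the bound is attained at `x = D/2`, `H = Hmin`, `Θ = Θmin`. -/
theorem stmt_4 (β₀ G₀ P D : ℝ) (hβ : 0 < β₀) (hG : 0 < G₀) (hP : 0 < P) (hD : 0 < D)
    (Hmin Θmin : ℝ) (hHmin : 0 < Hmin) (hΘmin : 0 < Θmin) (hΘmin' : Θmin < π / 2) :
    (∀ x : ℝ, ∀ H : ℝ, Hmin ≤ H → ∀ Θ ∈ Set.Ico Θmin (π / 2),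
      Q β₀ G₀ P (D / 2) x H Θ ≤ β₀ * G₀ * P / (Θmin ^ 2 * Hmin ^ 2)) ∧
    Q β₀ G₀ P (D / 2) (D / 2) Hmin Θmin = β₀ * G₀ * P / (Θmin ^ 2 * Hmin ^ 2) := by
  have hC : 0 < β₀ * G₀ * P := by positivity
  constructor
  · rintro x H hH Θ ⟨hΘ, -⟩
    unfold Q
    split_ifs
    · have hsq : Hmin ^ 2 ≤ (x - D / 2) ^ 2 + H ^ 2 := by
        nlinarith [sq_nonneg (x - D / 2)]
      gcongr
    · positivity
  · have htan : 0 ≤ Real.tan Θmin := (Real.tan_pos_of_pos_of_lt_pi_div_two hΘmin hΘmin').le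
    simp [Q, htan]
end

section
/- (Lemma 3.2) Let 0 < H_min ≤ H_max, 0 < Θ_min ≤ Θ_max < π/2, and let (x, H, Θ) satisfy 0 ≤ x ≤ D/2, H ∈ [H_min, H_max], Θ ∈ [Θ_min, Θ_max], and the strict coverage slack H·tan Θ > x + D/2. If moreover H > H_min or Θ > Θ_min, then there exist H' ∈ [H_min, H], Θ' ∈ [Θ_min, Θ] with H'·tan Θ' ≥ x + D/2 and Q₁(x, H', Θ') + Q₂(x, H', Θ') > Q₁(x, H, Θ) + Q₂(x, H, Θ). Consequently, at any maximizer of the two-ER simultaneous-coverage problem the constraint H·tan Θ = x + D/2 is active (unless both H = H_min and Θ = Θ_min). -/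
open Real MeasureTheory

theorem Q_lt_Q {β₀ G₀ P xhat x H Θ H' Θ' : ℝ} (hβ : 0 < β₀) (hG : 0 < G₀) (hP : 0 < P)
    (hH' : 0 < H') (hΘ' : 0 < Θ') (hH : H' ≤ H) (hΘ : Θ' ≤ Θ) (hne : H' < H ∨ Θ' < Θ)
    (hcov : |x - xhat| ≤ H' * Real.tan Θ') :
    Q β₀ G₀ P xhat x H Θ < Q β₀ G₀ P xhat x H' Θ' := by
  have hc : 0 < β₀ * G₀ * P := by positivity
  have hΘpos : 0 < Θ := hΘ'.trans_le hΘ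
  have hcov' : |x - xhat| / H' ≤ Real.tan Θ' := by
    rw [div_le_iff₀ hH']
    linarith
  have hden : Θ' ^ 2 * ((x - xhat) ^ 2 + H' ^ 2) < Θ ^ 2 * ((x - xhat) ^ 2 + H ^ 2) := by
    rcases hne with h | h
    · have h1 : Θ' ^ 2 ≤ Θ ^ 2 := by gcongr
      have h2 : (x - xhat) ^ 2 + H' ^ 2 < (x - xhat) ^ 2 + H ^ 2 := by gcongr
      exact mul_lt_mul' h1 h2 (by positivity) (by positivity)
    · have h1 : Θ' ^ 2 < Θ ^ 2 := by gcongr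
      have h2 : (x - xhat) ^ 2 + H' ^ 2 ≤ (x - xhat) ^ 2 + H ^ 2 := by gcongr
      exact mul_lt_mul h1 h2 (by positivity) (by positivity)
  have hpos : 0 < Θ' ^ 2 * ((x - xhat) ^ 2 + H' ^ 2) := by positivity
  unfold Q
  rw [if_pos hcov']
  split_ifs
  · exact div_lt_div_of_pos_left hc hpos hden
  · exact div_pos hc hpos

/-- Lemma 3.2: if the coverage constraint `H·tan Θ ≥ x + D/2` is satisfied with strict slack
and `H > Hmin` or `Θ > Θmin`, then the altitude/beamwidth can be reduced, keeping coverage,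
while strictly increasing the sum of received powers; hence the coverage constraint is active
at any maximizer of the two-ER simultaneous-coverage problem. -/
theorem stmt_5 (β₀ G₀ P D : ℝ) (hβ : 0 < β₀) (hG : 0 < G₀) (hP : 0 < P) (hD : 0 < D)
    (Hmin Hmax Θmin Θmax : ℝ)
    (hH1 : 0 < Hmin) (hH2 : Hmin ≤ Hmax) (hΘ1 : 0 < Θmin) (hΘ2 : Θmin ≤ Θmax)
    (hΘ3 : Θmax < π / 2)
    (x H Θ : ℝ) (hx0 : 0 ≤ x) (hxD : x ≤ D / 2)
    (hH : H ∈ Set.Icc Hmin Hmax) (hΘ : Θ ∈ Set.Icc Θmin Θmax)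
    (hslack : x + D / 2 < H * Real.tan Θ)
    (hne : Hmin < H ∨ Θmin < Θ) :
    ∃ H' ∈ Set.Icc Hmin H, ∃ Θ' ∈ Set.Icc Θmin Θ,
      x + D / 2 ≤ H' * Real.tan Θ' ∧
      Q β₀ G₀ P (-(D / 2)) x H Θ + Q β₀ G₀ P (D / 2) x H Θ <
        Q β₀ G₀ P (-(D / 2)) x H' Θ' + Q β₀ G₀ P (D / 2) x H' Θ' := by
  obtain ⟨hHl, -⟩ := hH
  obtain ⟨hΘl, hΘu⟩ := hΘ
  have hHpos : 0 < H := hH1.trans_le hHl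
  have hΘpos : 0 < Θ := hΘ1.trans_le hΘl
  have hΘlt : Θ < π / 2 := hΘu.trans_lt hΘ3
  have habs₁ : |x - -(D / 2)| ≤ x + D / 2 := abs_le.2 ⟨by linarith, by linarith⟩
  have habs₂ : |x - D / 2| ≤ x + D / 2 := abs_le.2 ⟨by linarith, by linarith⟩
  obtain ⟨H', hH', Θ', hΘ', hcov, hlt⟩ : ∃ H' ∈ Set.Icc Hmin H, ∃ Θ' ∈ Set.Icc Θmin Θ,
      x + D / 2 ≤ H' * Real.tan Θ' ∧ (H' < H ∨ Θ' < Θ) := by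
    rcases hne with h | h
    · have htan : 0 < Real.tan Θ := Real.tan_pos_of_pos_of_lt_pi_div_two hΘpos hΘlt
      have hlt : max Hmin ((x + D / 2) / Real.tan Θ) < H :=
        max_lt h ((div_lt_iff₀ htan).2 hslack)
      exact ⟨_, ⟨le_max_left _ _, hlt.le⟩, Θ, ⟨hΘl, le_rfl⟩,
        (div_le_iff₀ htan).1 (le_max_right _ _), Or.inl hlt⟩
    · have harc : Real.arctan ((x + D / 2) / H) < Θ := by
        rw [← Real.arctan_tan (by linarith) hΘlt]
        exact Real.arctan_strictMono ((div_lt_iff₀' hHpos).2 hslack)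
      have hlt : max Θmin (Real.arctan ((x + D / 2) / H)) < Θ := max_lt h harc
      refine ⟨H, ⟨hHl, le_rfl⟩, _, ⟨le_max_left _ _, hlt.le⟩, ?_, Or.inr hlt⟩
      rw [← div_le_iff₀' hHpos]
      calc (x + D / 2) / H = Real.tan (Real.arctan ((x + D / 2) / H)) :=
            (Real.tan_arctan _).symm
        _ ≤ _ := Real.strictMonoOn_tan.monotoneOn (Real.arctan_mem_Ioo _)
            ⟨(Real.neg_pi_div_two_lt_arctan _).trans_le (le_max_right _ _), hlt.trans hΘlt⟩
            (le_max_right _ _)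
  have hH'pos := hH1.trans_le hH'.1
  have hΘ'pos := hΘ1.trans_le hΘ'.1
  exact ⟨H', hH', Θ', hΘ', hcov, add_lt_add
    (Q_lt_Q hβ hG hP hH'pos hΘ'pos hH'.2 hΘ'.2 hlt (habs₁.trans hcov))
    (Q_lt_Q hβ hG hP hH'pos hΘ'pos hH'.2 hΘ'.2 hlt (habs₂.trans hcov))⟩
end

section
/- For every x ∈ [0, D/2] and Θ ∈ (0, π/2), setting H = (x + D/2)/tan Θ, the beam covers both ERs (i.e., tan Θ ≥ |x − x̂_k|/H for k = 1, 2), and the average received power equals ψ, i.e., (1/2)·(Q₁(x, H, Θ) + Q₂(x, H, Θ)) = ψ(x, Θ). -/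
open Real MeasureTheory

/-- The objective function `ψ` of problem (16). -/
noncomputable def psi (β₀ G₀ P D x Θ : ℝ) : ℝ :=
  β₀ * G₀ * P / (2 * Θ ^ 2) *
    (1 / ((x - D / 2) ^ 2 + (x + D / 2) ^ 2 / Real.tan Θ ^ 2) +
      Real.sin Θ ^ 2 / (x + D / 2) ^ 2)

/-- With `H = (x + D/2)/tan Θ`, the beam covers both ERs and the average received power
equals `ψ(x, Θ)`. -/
theorem stmt_6 (β₀ G₀ P D : ℝ) (hβ : 0 < β₀) (hG : 0 < G₀) (hP : 0 < P) (hD : 0 < D)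
    (x Θ : ℝ) (hx : x ∈ Set.Icc 0 (D / 2)) (hΘ : Θ ∈ Set.Ioo 0 (π / 2)) :
    |x - (-(D / 2))| / ((x + D / 2) / Real.tan Θ) ≤ Real.tan Θ ∧
    |x - D / 2| / ((x + D / 2) / Real.tan Θ) ≤ Real.tan Θ ∧
    (Q β₀ G₀ P (-(D / 2)) x ((x + D / 2) / Real.tan Θ) Θ +
      Q β₀ G₀ P (D / 2) x ((x + D / 2) / Real.tan Θ) Θ) / 2 = psi β₀ G₀ P D x Θ := by
  obtain ⟨hx0, hxD⟩ := hx
  have ht : 0 < Real.tan Θ := Real.tan_pos_of_pos_of_lt_pi_div_two hΘ.1 hΘ.2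
  have hs : 0 < Real.sin Θ := Real.sin_pos_of_pos_of_lt_pi hΘ.1 (by linarith [hΘ.2, Real.pi_pos])
  have hc : 0 < Real.cos Θ := Real.cos_pos_of_mem_Ioo ⟨by linarith [hΘ.1, Real.pi_pos], hΘ.2⟩
  have ha : 0 < x + D / 2 := by linarith
  have hΘ0 : Θ ≠ 0 := hΘ.1.ne'
  have near : |x - (-(D / 2))| / ((x + D / 2) / Real.tan Θ) ≤ Real.tan Θ := by
    rw [sub_neg_eq_add, abs_of_pos ha, div_le_iff₀ (by positivity), mul_div_cancel₀ _ ht.ne']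
  have far : |x - D / 2| / ((x + D / 2) / Real.tan Θ) ≤ Real.tan Θ := by
    rw [div_le_iff₀ (by positivity), mul_div_cancel₀ _ ht.ne', abs_le]
    constructor <;> linarith
  have slant : (x + D / 2) ^ 2 + ((x + D / 2) / Real.tan Θ) ^ 2
      = (x + D / 2) ^ 2 / Real.sin Θ ^ 2 := by
    rw [Real.tan_eq_sin_div_cos]
    field_simp
    exact Real.sin_sq_add_cos_sq Θ
  refine ⟨near, far, ?_⟩
  rw [Q, Q, if_pos near, if_pos far, psi, sub_neg_eq_add, slant, div_pow]
  have hfar : (x - D / 2) ^ 2 + (x + D / 2) ^ 2 / Real.tan Θ ^ 2 ≠ 0 := by positivity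
  generalize (x - D / 2) ^ 2 + (x + D / 2) ^ 2 / Real.tan Θ ^ 2 = d at hfar
  field_simp
  ring
end

section
/- (Lemma 3.3, first case) For every fixed Θ ∈ (0, π/4], the derivative ∂ψ/∂x(x, Θ) is strictly negative for every x ∈ [0, D/2], and consequently x ↦ ψ(x, Θ) is strictly decreasing on [0, D/2]; hence on any subinterval [a, b] ⊆ [0, D/2], ψ(·, Θ) is maximized at the left endpoint a. -/
open Real MeasureTheory

/-- The denominator of the first summand of `ψ` is positive when `x + D / 2` is. -/
lemma psi_denom_pos {D x Θ : ℝ} (hx : 0 < x + D / 2) (ht : 0 < Real.tan Θ) :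
    0 < (x - D / 2) ^ 2 + (x + D / 2) ^ 2 / Real.tan Θ ^ 2 := by
  positivity

/-- The partial derivative of `ψ` with respect to `x`. -/
lemma hasDerivAt_psi (β₀ G₀ P : ℝ) {D x Θ : ℝ} (hx : 0 < x + D / 2) (ht : 0 < Real.tan Θ) :
    HasDerivAt (fun y => psi β₀ G₀ P D y Θ)
      (-(β₀ * G₀ * P / Θ ^ 2) *
        ((x - D / 2 + (x + D / 2) / Real.tan Θ ^ 2) /
            ((x - D / 2) ^ 2 + (x + D / 2) ^ 2 / Real.tan Θ ^ 2) ^ 2 +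
          Real.sin Θ ^ 2 / (x + D / 2) ^ 3)) x := by
  have hQ := psi_denom_pos hx ht
  have hsub : HasDerivAt (fun y : ℝ => (y - D / 2) ^ 2) (2 * (x - D / 2)) x := by
    simpa using ((hasDerivAt_id x).sub_const (D / 2)).fun_pow 2
  have hadd : HasDerivAt (fun y : ℝ => (y + D / 2) ^ 2) (2 * (x + D / 2)) x := by
    simpa using ((hasDerivAt_id x).add_const (D / 2)).fun_pow 2
  have h := ((((hasDerivAt_const x (1 : ℝ)).fun_div
    (hsub.fun_add (hadd.div_const (Real.tan Θ ^ 2))) hQ.ne').fun_add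
    ((hasDerivAt_const x (Real.sin Θ ^ 2)).fun_div hadd (pow_ne_zero 2 hx.ne')))).const_mul
    (β₀ * G₀ * P / (2 * Θ ^ 2))
  refine h.congr_deriv ?_
  have hcube : Real.sin Θ ^ 2 * (2 * (x + D / 2)) / ((x + D / 2) ^ 2) ^ 2 =
      2 * (Real.sin Θ ^ 2 / (x + D / 2) ^ 3) := by
    field_simp
  simp only [zero_mul, zero_sub, neg_div, hcube]
  ring

/-- For `Θ ∈ (0, π/4]` the partial derivative of `ψ` in `x` is negative on `[0, ∞)`. -/
lemma psi_deriv_neg {β₀ G₀ P D x Θ : ℝ} (hβ : 0 < β₀) (hG : 0 < G₀) (hP : 0 < P) (hD : 0 < D)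
    (hΘ : Θ ∈ Set.Ioc 0 (π / 4)) (hx : 0 ≤ x) :
    -(β₀ * G₀ * P / Θ ^ 2) *
        ((x - D / 2 + (x + D / 2) / Real.tan Θ ^ 2) /
            ((x - D / 2) ^ 2 + (x + D / 2) ^ 2 / Real.tan Θ ^ 2) ^ 2 +
          Real.sin Θ ^ 2 / (x + D / 2) ^ 3) < 0 := by
  obtain ⟨h0, h1⟩ := hΘ
  have hπ := Real.pi_pos
  have ht : 0 < Real.tan Θ := Real.tan_pos_of_pos_of_lt_pi_div_two h0 (by linarith)
  have ht1 : Real.tan Θ ≤ 1 := by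
    rw [← Real.tan_pi_div_four]
    exact Real.strictMonoOn_tan.monotoneOn ⟨by linarith, by linarith⟩
      ⟨by linarith, by linarith⟩ h1
  have hs : 0 < Real.sin Θ := Real.sin_pos_of_pos_of_lt_pi h0 (by linarith)
  have hle : x + D / 2 ≤ (x + D / 2) / Real.tan Θ ^ 2 :=
    le_div_self (by positivity) (by positivity) (pow_le_one₀ ht.le ht1)
  have hnum : 0 ≤ x - D / 2 + (x + D / 2) / Real.tan Θ ^ 2 := by linarith
  exact mul_neg_of_neg_of_pos (neg_neg_of_pos (by positivity)) (by positivity)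

/-- Lemma 3.3, first case: for `Θ ∈ (0, π/4]` the derivative `∂ψ/∂x` is strictly negative on
`[0, D/2]`, so `ψ(·, Θ)` is strictly decreasing there and is maximized at the left endpoint of
any subinterval `[a, b] ⊆ [0, D/2]`. -/
theorem stmt_8 (β₀ G₀ P D : ℝ) (hβ : 0 < β₀) (hG : 0 < G₀) (hP : 0 < P) (hD : 0 < D)
    (Θ : ℝ) (hΘ : Θ ∈ Set.Ioc 0 (π / 4)) :
    (∀ x ∈ Set.Icc 0 (D / 2),
      -(β₀ * G₀ * P / Θ ^ 2) *
        ((x - D / 2 + (x + D / 2) / Real.tan Θ ^ 2) /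
            ((x - D / 2) ^ 2 + (x + D / 2) ^ 2 / Real.tan Θ ^ 2) ^ 2 +
          Real.sin Θ ^ 2 / (x + D / 2) ^ 3) < 0) ∧
    StrictAntiOn (fun x => psi β₀ G₀ P D x Θ) (Set.Icc 0 (D / 2)) ∧
    ∀ a b : ℝ, 0 ≤ a → a ≤ b → b ≤ D / 2 →
      ∀ x ∈ Set.Icc a b, psi β₀ G₀ P D x Θ ≤ psi β₀ G₀ P D a Θ := by
  have hderiv : ∀ x ∈ Set.Icc 0 (D / 2), HasDerivAt (fun y => psi β₀ G₀ P D y Θ) _ x :=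
    fun x hx => hasDerivAt_psi β₀ G₀ P (by linarith [hx.1])
      (Real.tan_pos_of_pos_of_lt_pi_div_two hΘ.1 (by linarith [hΘ.2, Real.pi_pos]))
  have hanti : StrictAntiOn (fun x => psi β₀ G₀ P D x Θ) (Set.Icc 0 (D / 2)) := by
    refine strictAntiOn_of_deriv_neg (convex_Icc _ _)
      (fun x hx => (hderiv x hx).continuousAt.continuousWithinAt) fun x hx => ?_
    have hx' := interior_subset hx
    rw [(hderiv x hx').deriv]
    exact psi_deriv_neg hβ hG hP hD hΘ hx'.1
  exact ⟨fun x hx => psi_deriv_neg hβ hG hP hD hΘ hx.1, hanti, fun a b ha hab hb x hx =>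
    hanti.antitoneOn ⟨ha, hab.trans hb⟩ ⟨ha.trans hx.1, hx.2.trans hb⟩ hx.1⟩
end
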